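/- arXiv:2406.14431 — 2 statements merged into one kernel-verified Lean document; each statement's English description precedes it below -/
import Mathlib

section
/- Let α be a Liouville number. Then there exists a smooth function f : 𝕋² → ℂ with f_{0,0} = 0 such that the equation Xg = f, where X = ∂_x + α∂_y, has no smooth solution g. Consequently the directional derivative operator X on C^∞(𝕋²) does not have closed range, equivalently the degree-one foliated cohomology of the Kronecker foliation of slope α is non-Hausdorff. -/
open scoped Real

/-- A function `ℝ² → ℂ` is `ℤ²`-periodic, i.e. descends to the 2-torus `𝕋² = ℝ²/ℤ²`. -/
def IsPeriodic2 (f : ℝ × ℝ → ℂ) : Prop :=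
  ∀ (x y : ℝ) (k l : ℤ), f (x + (k : ℝ), y + (l : ℝ)) = f (x, y)

/-- The `(m,n)`-th Fourier coefficient of a (periodic) function on the 2-torus. -/
noncomputable def fourierCoef2 (f : ℝ × ℝ → ℂ) (m n : ℤ) : ℂ :=
  ∫ x in (0:ℝ)..1, ∫ y in (0:ℝ)..1,
    f (x, y) * Complex.exp (-(2 * (π : ℂ) * Complex.I) * ((m : ℂ) * (x : ℂ) + (n : ℂ) * (y : ℂ)))

/-- The exponential `s ↦ exp(2πis)` on the line. -/
noncomputable def waveExp (s : ℝ) : ℂ := Complex.exp (2 * π * Complex.I * s)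

theorem norm_waveExp (s : ℝ) : ‖waveExp s‖ = 1 := by
  have : 2 * π * Complex.I * s = ((2 * π * s : ℝ) : ℂ) * Complex.I := by push_cast; ring
  rw [waveExp, this, Complex.norm_exp_ofReal_mul_I]

theorem waveExp_add_intCast (s : ℝ) (k : ℤ) : waveExp (s + k) = waveExp s := by
  have : 2 * π * Complex.I * ((s + k : ℝ) : ℂ)
      = 2 * π * Complex.I * s + k * (2 * π * Complex.I) := by push_cast; ring
  rw [waveExp, this, Complex.exp_periodic.int_mul k]; rfl

theorem hasDerivAt_waveExp (s : ℝ) :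
    HasDerivAt waveExp (2 * π * Complex.I * waveExp s) s := by
  have := ((Complex.ofRealCLM.hasDerivAt (x := s)).const_mul (2 * π * Complex.I)).cexp
  have h : (2 * π * Complex.I * waveExp s)
      = Complex.exp (2 * π * Complex.I * Complex.ofRealCLM s)
        * (2 * π * Complex.I * Complex.ofRealCLM 1) := by
    simp [waveExp, mul_comm]
  rw [h]
  exact this

theorem hasDerivAt_waveExp_add_mul (s d t : ℝ) :
    HasDerivAt (fun t => waveExp (s + d * t)) (2 * π * Complex.I * d * waveExp (s + d * t)) t := by
  have h1 : HasDerivAt (fun t : ℝ => s + d * t) d t := by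
    simpa using ((hasDerivAt_id t).const_mul d).const_add s
  have h2 : 2 * π * Complex.I * d * waveExp (s + d * t)
      = d • (2 * π * Complex.I * waveExp (s + d * t)) := by
    rw [Complex.real_smul]
    ring
  rw [h2]
  exact (hasDerivAt_waveExp _).scomp t h1

theorem contDiff_waveExp {n : WithTop ℕ∞} : ContDiff ℝ n waveExp :=
  (contDiff_const.mul Complex.ofRealCLM.contDiff).cexp

theorem iteratedDeriv_waveExp (k : ℕ) :
    iteratedDeriv k waveExp = fun s => (2 * π * Complex.I) ^ k * waveExp s := by
  induction k with
  | zero => simp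
  | succ k ih =>
    rw [iteratedDeriv_succ, ih]
    funext s
    rw [((hasDerivAt_waveExp s).const_mul _).deriv]
    ring

theorem norm_iteratedFDeriv_waveExp_comp_le {E : Type*} [NormedAddCommGroup E] [NormedSpace ℝ E]
    (L : E →L[ℝ] ℝ) (k : ℕ) (x : E) :
    ‖iteratedFDeriv ℝ k (fun q => waveExp (L q)) x‖ ≤ (2 * π) ^ k * ‖L‖ ^ k := by
  have h := L.iteratedFDeriv_comp_right (contDiff_waveExp (n := k)) x le_rfl
  change ‖iteratedFDeriv ℝ k (waveExp ∘ L) x‖ ≤ _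
  rw [h]
  refine (ContinuousMultilinearMap.norm_compContinuousLinearMap_le _ _).trans ?_
  rw [norm_iteratedFDeriv_eq_norm_iteratedDeriv, iteratedDeriv_waveExp]
  simp [norm_waveExp, abs_of_pos Real.pi_pos]

theorem integral_waveExp_add_mul (s : ℝ) {n : ℤ} (hn : n ≠ 0) :
    ∫ y in (0 : ℝ)..1, waveExp (s + n * y) = 0 := by
  have h0 : (2 * π * Complex.I * n : ℂ) ≠ 0 := by
    simp [hn, Real.pi_ne_zero]
  have hd : ∀ y ∈ Set.uIcc (0 : ℝ) 1,
      HasDerivAt (fun y : ℝ => (2 * π * Complex.I * n : ℂ)⁻¹ * waveExp (s + n * y))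
        (waveExp (s + n * y)) y := by
    intro y _
    have := (hasDerivAt_waveExp_add_mul s n y).const_mul (2 * π * Complex.I * n : ℂ)⁻¹
    rwa [Complex.ofReal_intCast, inv_mul_cancel_left₀ h0] at this
  rw [intervalIntegral.integral_eq_sub_of_hasDerivAt hd]
  · simp [waveExp_add_intCast]
  · exact ((contDiff_waveExp (n := 0)).continuous.comp (by fun_prop)).intervalIntegrable _ _

theorem IsPeriodic2.exists_norm_le {g : ℝ × ℝ → ℂ} (hp : IsPeriodic2 g) (hc : Continuous g) :
    ∃ M, ∀ q, ‖g q‖ ≤ M := by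
  obtain ⟨M, hM⟩ := (isCompact_Icc (a := ((0 : ℝ), (0 : ℝ)))
    (b := (1, 1))).exists_bound_of_continuousOn hc.continuousOn
  refine ⟨M, fun ⟨x, y⟩ => ?_⟩
  have h := hp (Int.fract x) (Int.fract y) ⌊x⌋ ⌊y⌋
  rw [Int.fract_add_floor, Int.fract_add_floor] at h
  rw [h]
  exact hM _ ⟨⟨Int.fract_nonneg x, Int.fract_nonneg y⟩,
    ⟨(Int.fract_lt_one x).le, (Int.fract_lt_one y).le⟩⟩

theorem Liouville.exists_seq {α : ℝ} (hα : Liouville α) :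
    ∃ a b : ℕ → ℤ, (∀ p, 1 < b p) ∧ (∀ p, α * b p - a p ≠ 0) ∧
      ∀ p, |α * b p - a p| ≤ 1 / (b p : ℝ) ^ p := by
  choose a b hb hne hlt using fun p => hα (p + 1)
  have hb0 : ∀ p, (0 : ℝ) < b p := fun p => by exact_mod_cast (zero_lt_one.trans (hb p))
  have key : ∀ p, α * b p - a p = (α - a p / b p) * b p := fun p => by
    have := (hb0 p).ne'
    field_simp
  refine ⟨a, b, hb, fun p => ?_, fun p => ?_⟩
  · rw [key]
    exact mul_ne_zero (sub_ne_zero.2 (hne p)) (hb0 p).ne'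
  · rw [key, abs_mul, abs_of_pos (hb0 p)]
    calc _ ≤ 1 / (b p : ℝ) ^ (p + 1) * b p := by gcongr; exacts [(hb0 p).le, (hlt p).le]
      _ = _ := by have := (hb0 p).ne'; rw [pow_succ]; field_simp

theorem summable_mul_abs_mul_pow {b : ℕ → ℤ} {D : ℕ → ℝ} (hb : ∀ p, 1 < b p)
    (hD : ∀ p, |D p| ≤ 1 / (b p : ℝ) ^ p) (k : ℕ) :
    Summable fun p : ℕ => (p : ℝ) * |D p| * (b p : ℝ) ^ k := by
  have hs : Summable fun p : ℕ => (2 : ℝ) ^ k * ((p : ℝ) ^ 1 * (1 / 2 : ℝ) ^ p) := by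
    have hr : ‖(1 / 2 : ℝ)‖ < 1 := by norm_num
    exact (summable_pow_mul_geometric_of_norm_lt_one 1 hr).mul_left _
  refine hs.of_norm_bounded_eventually_nat ?_
  filter_upwards [Filter.eventually_ge_atTop k] with p hp
  have hb2 : (2 : ℝ) ≤ b p := by exact_mod_cast hb p
  have hb0 : (0 : ℝ) < b p := by linarith
  have hle : |D p| * (b p : ℝ) ^ k ≤ 2 ^ k * (1 / 2 : ℝ) ^ p := by
    obtain ⟨j, rfl⟩ := Nat.exists_eq_add_of_le hp
    calc _ ≤ 1 / (b (k + j) : ℝ) ^ (k + j) * (b (k + j) : ℝ) ^ k := by gcongr; exact hD _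
      _ = 1 / (b (k + j) : ℝ) ^ j := by rw [pow_add]; field_simp
      _ ≤ 1 / 2 ^ j := by gcongr
      _ = _ := by rw [pow_add, one_div_pow, one_div_pow]; field_simp
  rw [Real.norm_of_nonneg (by positivity)]
  calc _ = (p : ℝ) * (|D p| * (b p : ℝ) ^ k) := by ring
    _ ≤ p * (2 ^ k * (1 / 2 : ℝ) ^ p) := by gcongr
    _ = _ := by ring

/-- The linear form `(x, y) ↦ -ax + by` on the plane. -/
noncomputable def planeForm (a b : ℤ) : ℝ × ℝ →L[ℝ] ℝ :=
  (b : ℝ) • ContinuousLinearMap.snd ℝ ℝ ℝ - (a : ℝ) • ContinuousLinearMap.fst ℝ ℝ ℝ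

theorem planeForm_apply (a b : ℤ) (q : ℝ × ℝ) : planeForm a b q = b * q.2 - a * q.1 := by
  simp [planeForm]

theorem norm_planeForm_le {α : ℝ} {a b : ℤ} (hb : 1 < b) (h : |α * b - a| ≤ 1) :
    ‖planeForm a b‖ ≤ (|α| + 2) * b := by
  have hb1 : (1 : ℝ) < b := by exact_mod_cast hb
  have ha : |(a : ℝ)| ≤ (|α| + 1) * b := by
    have h1 : |(a : ℝ)| ≤ |α * b| + |α * b - a| := by
      simpa using abs_sub (α * b) (α * b - a)
    rw [abs_mul, abs_of_pos (by linarith : (0 : ℝ) < b)] at h1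
    nlinarith
  have h2 : ‖planeForm a b‖ ≤ |(b : ℝ)| * 1 + |(a : ℝ)| * 1 := by
    refine (norm_sub_le _ _).trans ?_
    rw [norm_smul, norm_smul]
    gcongr
    exacts [le_rfl, ContinuousLinearMap.norm_snd_le .., le_rfl, ContinuousLinearMap.norm_fst_le ..]
  rw [abs_of_pos (by linarith : (0 : ℝ) < b)] at h2
  linarith

/-- A summable trigonometric series on the torus whose frequencies all have a nonzero second
component has vanishing mean. -/
theorem fourierCoef2_tsum_waveExp_eq_zero {c : ℕ → ℂ} {a b : ℕ → ℤ} (hb : ∀ p, b p ≠ 0)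
    (hc : Summable fun p => ‖c p‖) :
    fourierCoef2 (fun q => ∑' p, c p * waveExp (planeForm (a p) (b p) q)) 0 0 = 0 := by
  have hinner : ∀ x : ℝ,
      ∫ y in (0 : ℝ)..1, ∑' p, c p * waveExp (planeForm (a p) (b p) (x, y)) = 0 := by
    intro x
    have hs := intervalIntegral.hasSum_integral_of_dominated_convergence
      (μ := MeasureTheory.volume) (a := 0) (b := 1)
      (F := fun p y => c p * waveExp (planeForm (a p) (b p) (x, y)))
      (f := fun y => ∑' p, c p * waveExp (planeForm (a p) (b p) (x, y)))
      (fun p _ => ‖c p‖)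
      (fun p => by
        refine Continuous.aestronglyMeasurable ?_
        exact continuous_const.mul ((contDiff_waveExp (n := 0)).continuous.comp (by fun_prop)))
      (fun p => by simp [norm_waveExp])
      (by simp [hc])
      (by simp)
      (Filter.Eventually.of_forall fun y _ => by
        refine Summable.hasSum (Summable.of_norm ?_)
        simpa [norm_waveExp] using hc)
    rw [← hs.tsum_eq]
    have hz : ∀ p, ∫ y in (0 : ℝ)..1, c p * waveExp (planeForm (a p) (b p) (x, y)) = 0 := by
      intro p
      rw [intervalIntegral.integral_const_mul]
      have := integral_waveExp_add_mul (-(a p * x)) (hb p)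
      simp only [neg_add_eq_sub] at this
      simp [planeForm_apply, this]
    simp [hz]
  simp [fourierCoef2, hinner]

theorem contDiff_tsum_waveExp {c : ℕ → ℂ} {L : ℕ → ℝ × ℝ →L[ℝ] ℝ}
    (h : ∀ k : ℕ, Summable fun p => ‖c p‖ * ‖L p‖ ^ k) :
    ContDiff ℝ (⊤ : ℕ∞) fun q => ∑' p, c p * waveExp (L p q) := by
  have hw : ∀ (p : ℕ) (n : WithTop ℕ∞), ContDiff ℝ n fun q => waveExp (L p q) :=
    fun p n => contDiff_waveExp.comp (L p).contDiff
  refine contDiff_tsum (v := fun k p => (2 * π) ^ k * (‖c p‖ * ‖L p‖ ^ k))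
    (fun p => contDiff_const.mul (hw p _)) (fun k _ => (h k).mul_left _) fun k p q _ => ?_
  change ‖iteratedFDeriv ℝ k (c p • fun q => waveExp (L p q)) q‖ ≤ _
  rw [iteratedFDeriv_const_smul_apply (hw p k).contDiffAt, norm_smul]
  calc _ ≤ ‖c p‖ * ((2 * π) ^ k * ‖L p‖ ^ k) := by
        gcongr; exact norm_iteratedFDeriv_waveExp_comp_le _ _ _
    _ = _ := by ring

theorem isPeriodic2_tsum_waveExp (c : ℕ → ℂ) (a b : ℕ → ℤ) :
    IsPeriodic2 fun q => ∑' p, c p * waveExp (planeForm (a p) (b p) q) := by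
  intro x y k l
  refine tsum_congr fun p => ?_
  have : planeForm (a p) (b p) (x + k, y + l)
      = planeForm (a p) (b p) (x, y) + ((b p * l - a p * k : ℤ) : ℝ) := by
    simp only [planeForm_apply]; push_cast; ring
  rw [this, waveExp_add_intCast]

theorem waveExp_half : waveExp (1 / 2) = -1 := by
  rw [waveExp, ← Complex.exp_pi_mul_I]
  congr 1
  push_cast
  ring

/-- An antiderivative of the almost periodic series `∑ p, 2πi p δₚ exp(2πi δₚ t)` has unbounded
oscillation. -/
theorem exists_lt_norm_sub_of_hasDerivAt {δ : ℕ → ℝ} (hδ : ∀ p, δ p ≠ 0)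
    (hs : Summable fun p : ℕ => ‖(p * (2 * π * Complex.I * δ p) : ℂ)‖) {h : ℝ → ℂ}
    (hh : ∀ t, HasDerivAt h (∑' p : ℕ, p * (2 * π * Complex.I * δ p) * waveExp (δ p * t)) t)
    (M : ℝ) : ∃ t, M < ‖h t - h 0‖ := by
  have hterm : ∀ (p : ℕ) (t : ℝ), HasDerivAt (fun t : ℝ => (p : ℂ) * (waveExp (δ p * t) - 1))
      (p * (2 * π * Complex.I * δ p) * waveExp (δ p * t)) t := by
    intro p t
    have := ((hasDerivAt_waveExp_add_mul 0 (δ p) t).sub_const 1).const_mul (p : ℂ)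
    simpa only [zero_add, mul_assoc] using this
  have hbound : ∀ (p : ℕ) (t : ℝ), ‖p * (2 * π * Complex.I * δ p) * waveExp (δ p * t)‖
      ≤ ‖(p * (2 * π * Complex.I * δ p) : ℂ)‖ := by
    intro p t
    rw [norm_mul _ (waveExp _), norm_waveExp, mul_one]
  have hw0 : waveExp 0 = 1 := by simp [waveExp]
  have h0 : Summable fun p : ℕ => (p : ℂ) * (waveExp (δ p * 0) - 1) := by simp [hw0]
  have hsum := summable_of_summable_hasDerivAt hs hterm hbound h0
  have hH := hasDerivAt_tsum hs hterm hbound h0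
  have hconst : ∀ t, h t - h 0 = ∑' p : ℕ, (p : ℂ) * (waveExp (δ p * t) - 1) := by
    intro t
    have := is_const_of_deriv_eq_zero (fun t => ((hh t).sub (hH t)).differentiableAt)
      (fun t => by rw [((hh t).sub (hH t)).deriv, sub_self]) t 0
    simp only [Pi.sub_apply, mul_zero, hw0, sub_self, tsum_zero, sub_zero] at this
    rw [← this]
    ring
  obtain ⟨q, hq⟩ := exists_nat_gt M
  refine ⟨1 / 2 / δ q, ?_⟩
  rw [hconst]
  set t := 1 / 2 / δ q with ht
  have hmul_re : ∀ (p : ℕ) (z : ℂ), ((p : ℂ) * z).re = p * z.re := fun p z => by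
    simp
  have hre := (Complex.hasSum_re (hsum t).hasSum).neg
  have hle := le_hasSum hre q fun p _ => by
    have h1 := (Complex.re_le_norm (waveExp (δ p * t))).trans_eq (norm_waveExp _)
    have h2 : (0 : ℝ) ≤ p := p.cast_nonneg
    simp only [hmul_re, Complex.sub_re, Complex.one_re]
    nlinarith
  have hval : waveExp (δ q * t) = -1 := by
    rw [ht, mul_div_cancel₀ _ (hδ q), waveExp_half]
  rw [hval] at hle
  simp only [hmul_re, Complex.sub_re, Complex.neg_re, Complex.one_re] at hle
  have h3 := (neg_le_abs _).trans
    (Complex.abs_re_le_norm (∑' p : ℕ, (p : ℂ) * (waveExp (δ p * t) - 1)))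
  have h4 : (0 : ℝ) ≤ q := q.cast_nonneg
  linarith

/-- For a Liouville number `α` there is a smooth function `f` on `𝕋²` with vanishing mean
such that `Xg = f`, `X = ∂ₓ + α ∂_y`, has no smooth solution `g` (so the degree-one foliated
cohomology of the Kronecker foliation of slope `α` is non-Hausdorff). -/
theorem exists_no_smooth_solution_of_liouville (α : ℝ) (hα : Liouville α) :
    ∃ f : ℝ × ℝ → ℂ, ContDiff ℝ (⊤ : ℕ∞) f ∧ IsPeriodic2 f ∧ fourierCoef2 f 0 0 = 0 ∧
      ¬ ∃ g : ℝ × ℝ → ℂ, ContDiff ℝ (⊤ : ℕ∞) g ∧ IsPeriodic2 g ∧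
          ∀ p : ℝ × ℝ, fderiv ℝ g p (1, α) = f p := by
  obtain ⟨a, b, hb, hne, hle⟩ := hα.exists_seq
  set δ : ℕ → ℝ := fun p => α * b p - a p with hδ
  set c : ℕ → ℂ := fun p => p * (2 * π * Complex.I * δ p) with hc
  have hcn : ∀ p, ‖c p‖ = 2 * π * (p * |δ p|) := fun p => by
    simp only [hc, norm_mul, Complex.norm_natCast, Complex.norm_ofNat, Complex.norm_real,
      Complex.norm_I, Real.norm_eq_abs, abs_of_pos Real.pi_pos]
    ring
  have hδ1 : ∀ p, |δ p| ≤ 1 := fun p => by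
    have hb1 : (1 : ℝ) ≤ b p := by exact_mod_cast (hb p).le
    refine (hle p).trans ?_
    rw [div_le_one (by positivity)]
    exact one_le_pow₀ hb1
  have hsum : ∀ k : ℕ, Summable fun p => ‖c p‖ * ‖planeForm (a p) (b p)‖ ^ k := fun k => by
    refine Summable.of_nonneg_of_le (fun p => by positivity) (fun p => ?_)
      ((summable_mul_abs_mul_pow hb hle k).mul_left (2 * π * (|α| + 2) ^ k))
    calc _ ≤ ‖c p‖ * ((|α| + 2) * b p) ^ k := by
          gcongr; exact norm_planeForm_le (hb p) (hδ1 p)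
      _ = _ := by rw [hcn, mul_pow]; ring
  have hsum0 : Summable fun p => ‖c p‖ := by simpa using hsum 0
  refine ⟨fun q => ∑' p, c p * waveExp (planeForm (a p) (b p) q), contDiff_tsum_waveExp hsum,
    isPeriodic2_tsum_waveExp c a b,
    fourierCoef2_tsum_waveExp_eq_zero (fun p => (zero_lt_one.trans (hb p)).ne') hsum0, ?_⟩
  rintro ⟨g, hg, hgp, hgf⟩
  obtain ⟨M, hM⟩ := hgp.exists_norm_le hg.continuous
  have hline : ∀ t : ℝ, HasDerivAt (fun t : ℝ => g (t, α * t))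
      (∑' p : ℕ, c p * waveExp (δ p * t)) t := by
    intro t
    have h1 : HasDerivAt (fun t : ℝ => (t, α * t)) (1, α) t := by
      simpa using (hasDerivAt_id t).prodMk ((hasDerivAt_id t).const_mul α)
    have h2 := ((hg.differentiable (by simp)) (t, α * t)).hasFDerivAt.comp_hasDerivAt t h1
    rw [hgf] at h2
    have h3 : ∀ p, planeForm (a p) (b p) (t, α * t) = δ p * t := fun p => by
      simp only [planeForm_apply, hδ]; ring
    simp only [h3] at h2
    exact h2
  obtain ⟨t, ht⟩ := exists_lt_norm_sub_of_hasDerivAt hne hsum0 hline (M + M)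
  exact ht.not_ge ((norm_sub_le _ _).trans (add_le_add (hM _) (hM _)))
end

section
/- Let α be irrational and not a Liouville number. Then for every smooth function f : 𝕋² → ℂ with vanishing mean (f_{0,0} = 0) there is a smooth function g with Xg = f, where X = ∂_x + α∂_y. Hence the first foliated cohomology of the Kronecker foliation of slope α is one-dimensional (spanned by the class of the constant function 1). -/
open scoped Real

namespace KroneckerTorus

open Complex MeasureTheory intervalIntegral
open scoped ContDiff

/-! ### Calculus of periodic functions of two variables -/

theorem contDiff_fderiv_apply {f : ℝ × ℝ → ℂ} (hf : ContDiff ℝ ∞ f) (v : ℝ × ℝ) :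
    ContDiff ℝ ∞ fun p => fderiv ℝ f p v :=
  (hf.fderiv_right (m := ∞) (by simp)).clm_apply contDiff_const

theorem isPeriodic2_fderiv_apply {f : ℝ × ℝ → ℂ} (hf : IsPeriodic2 f) (v : ℝ × ℝ) :
    IsPeriodic2 fun p => fderiv ℝ f p v := by
  intro x y k l
  have h : (fun p : ℝ × ℝ => f (p + ((k : ℝ), (l : ℝ)))) = f := by
    ext ⟨a, b⟩
    exact hf a b k l
  have h' := fderiv_comp_add_right (𝕜 := ℝ) (f := f) (x := (x, y)) ((k : ℝ), (l : ℝ))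
  rw [h] at h'
  simp only [h', Prod.mk_add_mk]

theorem isPeriodic2_comp_swap {f : ℝ × ℝ → ℂ} (hf : IsPeriodic2 f) :
    IsPeriodic2 (f ∘ Prod.swap) :=
  fun x y k l => hf y x l k

theorem fderiv_comp_swap_apply {f : ℝ × ℝ → ℂ} (hf : ContDiff ℝ ∞ f) (v p : ℝ × ℝ) :
    fderiv ℝ (f ∘ Prod.swap) p v = fderiv ℝ f p.swap v.swap := by
  have hd : DifferentiableAt ℝ f p.swap := (hf.differentiable (by simp)) _
  have h : HasFDerivAt (f ∘ Prod.swap)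
      ((fderiv ℝ f p.swap).comp
        ((ContinuousLinearMap.snd ℝ ℝ ℝ).prod (ContinuousLinearMap.fst ℝ ℝ ℝ))) p :=
    HasFDerivAt.comp p hd.hasFDerivAt
      ((ContinuousLinearMap.snd ℝ ℝ ℝ).prod (ContinuousLinearMap.fst ℝ ℝ ℝ)).hasFDerivAt
  rw [h.fderiv]
  rfl

/-! ### Fourier coefficients -/

theorem fourierCoef2_comp_swap {f : ℝ × ℝ → ℂ} (hf : Continuous f) (m n : ℤ) :
    fourierCoef2 (f ∘ Prod.swap) m n = fourierCoef2 f n m := by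
  unfold fourierCoef2
  rw [intervalIntegral_intervalIntegral_swap]
  · simp only [Function.comp_apply, Prod.swap_prod_mk, add_comm]
  · refine (ContinuousOn.integrableOn_compact (isCompact_uIcc.prod isCompact_uIcc) ?_).mono_set
      (Set.prod_mono Set.uIoc_subset_uIcc Set.uIoc_subset_uIcc)
    refine Continuous.continuousOn ?_
    simp only [Function.uncurry_def]
    fun_prop

theorem integral_deriv_mul_exp {F F' : ℝ → ℂ} (hF : ∀ y, HasDerivAt F (F' y) y)
    (hF' : Continuous F') (h01 : F 1 = F 0) (a : ℂ) (n : ℤ) :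
    ∫ y in (0 : ℝ)..1, F' y * exp (-(2 * (π : ℂ) * I) * (a + (n : ℂ) * (y : ℂ))) =
      2 * π * I * n *
        ∫ y in (0 : ℝ)..1, F y * exp (-(2 * (π : ℂ) * I) * (a + (n : ℂ) * (y : ℂ))) := by
  have hFc : Continuous F := continuous_iff_continuousAt.2 fun y => (hF y).continuousAt
  set E : ℝ → ℂ := fun y => exp (-(2 * (π : ℂ) * I) * (a + (n : ℂ) * (y : ℂ))) with hE
  have hEc : Continuous E := by fun_prop
  have hEd : ∀ y, HasDerivAt E (-(2 * π * I * n) * E y) y := by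
    intro y
    have h1 : HasDerivAt (fun y : ℝ => -(2 * (π : ℂ) * I) * (a + (n : ℂ) * (y : ℂ)))
        (-(2 * (π : ℂ) * I) * ((n : ℂ) * 1)) y :=
      ((((hasDerivAt_id y).ofReal_comp).const_mul (n : ℂ)).const_add a).const_mul _
    convert! h1.cexp using 1
    simp only [hE]
    ring
  have hE01 : E 1 = E 0 := by
    have : -(2 * (π : ℂ) * I) * (a + (n : ℂ) * ((1 : ℝ) : ℂ)) =
        -(2 * (π : ℂ) * I) * (a + (n : ℂ) * ((0 : ℝ) : ℂ)) - n * (2 * π * I) := by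
      push_cast
      ring
    simp only [hE, this, exp_periodic.sub_int_mul_eq]
  have key := integral_eq_sub_of_hasDerivAt (a := 0) (b := 1)
    (fun y _ => (hF y).mul (hEd y))
    (Continuous.intervalIntegrable (by fun_prop) _ _)
  rw [intervalIntegral.integral_add (Continuous.intervalIntegrable (by fun_prop) _ _)
    (Continuous.intervalIntegrable (by fun_prop) _ _)] at key
  simp only [Pi.mul_apply, hE01, h01, sub_self] at key
  rw [eq_neg_of_add_eq_zero_left key, ← intervalIntegral.integral_neg,
    ← intervalIntegral.integral_const_mul]
  congr 1
  ext y
  ring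

theorem fourierCoef2_fderiv_snd {f : ℝ × ℝ → ℂ} (hf : ContDiff ℝ ∞ f) (hp : IsPeriodic2 f)
    (m n : ℤ) :
    fourierCoef2 (fun p => fderiv ℝ f p (0, 1)) m n = 2 * π * I * n * fourierCoef2 f m n := by
  unfold fourierCoef2
  rw [← intervalIntegral.integral_const_mul]
  congr 1
  ext x
  refine integral_deriv_mul_exp (F := fun y => f (x, y)) (fun y => ?_) ?_ ?_ _ n
  · have hd : HasFDerivAt f (fderiv ℝ f (x, y)) (x, y) :=
      (hf.differentiable (by simp) _).hasFDerivAt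
    exact hd.comp_hasDerivAt y ((hasDerivAt_const y x).prodMk (hasDerivAt_id y))
  · exact (contDiff_fderiv_apply hf (0, 1)).continuous.comp (by fun_prop)
  · simpa using hp x 0 0 1

theorem fourierCoef2_fderiv_fst {f : ℝ × ℝ → ℂ} (hf : ContDiff ℝ ∞ f) (hp : IsPeriodic2 f)
    (m n : ℤ) :
    fourierCoef2 (fun p => fderiv ℝ f p (1, 0)) m n = 2 * π * I * m * fourierCoef2 f m n := by
  have hswap : ContDiff ℝ ∞ (f ∘ Prod.swap) := hf.comp (contDiff_snd.prodMk contDiff_fst)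
  rw [← fourierCoef2_comp_swap hf.continuous n m,
    ← fourierCoef2_fderiv_snd hswap (isPeriodic2_comp_swap hp),
    ← fourierCoef2_comp_swap (contDiff_fderiv_apply hf (1, 0)).continuous]
  congr 1
  ext p
  exact (fderiv_comp_swap_apply hf (0, 1) p).symm

theorem fourierCoef2_add {f g : ℝ × ℝ → ℂ} (hf : Continuous f) (hg : Continuous g) (m n : ℤ) :
    fourierCoef2 (fun p => f p + g p) m n = fourierCoef2 f m n + fourierCoef2 g m n := by
  unfold fourierCoef2
  rw [← intervalIntegral.integral_add]
  · congr 1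
    ext x
    rw [← intervalIntegral.integral_add]
    · simp only [add_mul]
    all_goals exact Continuous.intervalIntegrable (by fun_prop) _ _
  all_goals
    refine Continuous.intervalIntegrable ?_ _ _
    refine continuous_parametric_intervalIntegral_of_continuous' ?_ _ _
    simp only [Function.uncurry_def]
    fun_prop

theorem fourierCoef2_const_mul (c : ℂ) (f : ℝ × ℝ → ℂ) (m n : ℤ) :
    fourierCoef2 (fun p => c * f p) m n = c * fourierCoef2 f m n := by
  simp only [fourierCoef2, mul_assoc, intervalIntegral.integral_const_mul]

theorem fourierCoef2_const_zero_zero (c : ℂ) : fourierCoef2 (fun _ => c) 0 0 = c := by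
  simp [fourierCoef2]

theorem fourierCoef2_const_add_fderiv {g : ℝ × ℝ → ℂ} (hg : ContDiff ℝ ∞ g) (hp : IsPeriodic2 g)
    (c : ℂ) (a : ℝ) : fourierCoef2 (fun p => c + fderiv ℝ g p (1, a)) 0 0 = c := by
  have hsplit : (fun p => fderiv ℝ g p (1, a)) =
      fun p => fderiv ℝ g p (1, 0) + (a : ℂ) * fderiv ℝ g p (0, 1) := by
    ext p
    have : ((1, a) : ℝ × ℝ) = (1, 0) + a • (0, 1) := by simp
    rw [this, map_add, map_smul, real_smul]
  have h1 := (contDiff_fderiv_apply hg (1, 0)).continuous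
  have h2 := (contDiff_fderiv_apply hg (0, 1)).continuous
  rw [fourierCoef2_add continuous_const (contDiff_fderiv_apply hg (1, a)).continuous, hsplit,
    fourierCoef2_add (g := fun p => (a : ℂ) * _) h1 (continuous_const.mul h2), fourierCoef2_const_mul,
    fourierCoef2_fderiv_fst hg hp, fourierCoef2_fderiv_snd hg hp, fourierCoef2_const_zero_zero]
  simp

/-! ### Rapid decay -/

/-- The weight `1 + |m| + |n|` on the lattice `ℤ²`. -/
def weight (q : ℤ × ℤ) : ℝ := 1 + |(q.1 : ℝ)| + |(q.2 : ℝ)|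

theorem one_le_weight (q : ℤ × ℤ) : 1 ≤ weight q := by
  unfold weight
  linarith [abs_nonneg (q.1 : ℝ), abs_nonneg (q.2 : ℝ)]

/-- A family on `ℤ²` decaying faster than every power of the weight. -/
def RapidDecay (c : ℤ × ℤ → ℂ) : Prop :=
  ∀ k : ℕ, ∃ C : ℝ, ∀ q, weight q ^ k * ‖c q‖ ≤ C

theorem summable_one_div_one_add_abs_sq : Summable fun n : ℤ => 1 / (1 + |(n : ℝ)|) ^ 2 := by
  have h : Summable fun n : ℕ => 1 / (1 + (n : ℝ)) ^ 2 := by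
    have := (summable_nat_add_iff 1).2 (Real.summable_one_div_nat_pow.2 one_lt_two)
    simpa [add_comm] using this
  refine Summable.of_nat_of_neg ?_ ?_ <;> simpa using h

theorem summable_one_div_weight_pow_four : Summable fun q : ℤ × ℤ => 1 / weight q ^ 4 := by
  have h := summable_one_div_one_add_abs_sq.mul_of_nonneg summable_one_div_one_add_abs_sq
    (fun _ => by positivity) (fun _ => by positivity)
  refine h.of_nonneg_of_le (fun q => ?_) (fun q => ?_)
  · have := one_le_weight q
    positivity
  · rw [div_mul_div_comm, one_mul]
    refine one_div_le_one_div_of_le (by positivity) ?_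
    have h1 : 1 + |(q.1 : ℝ)| ≤ weight q := by
      unfold weight
      linarith [abs_nonneg (q.2 : ℝ)]
    have h2 : 1 + |(q.2 : ℝ)| ≤ weight q := by
      unfold weight
      linarith [abs_nonneg (q.1 : ℝ)]
    calc (1 + |(q.1 : ℝ)|) ^ 2 * (1 + |(q.2 : ℝ)|) ^ 2 ≤ weight q ^ 2 * weight q ^ 2 := by gcongr
      _ = weight q ^ 4 := by ring

theorem RapidDecay.summable {c : ℤ × ℤ → ℂ} (hc : RapidDecay c) (k : ℕ) :
    Summable fun q => weight q ^ k * ‖c q‖ := by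
  obtain ⟨C, hC⟩ := hc (k + 4)
  refine (summable_one_div_weight_pow_four.mul_left C).of_nonneg_of_le (fun q => ?_) fun q => ?_
  · have := one_le_weight q
    positivity
  · have hw : 0 < weight q ^ 4 := by
      have := one_le_weight q
      positivity
    rw [mul_one_div, le_div_iff₀ hw]
    calc weight q ^ k * ‖c q‖ * weight q ^ 4 = weight q ^ (k + 4) * ‖c q‖ := by ring
      _ ≤ C := hC q

theorem RapidDecay.summable_norm {c : ℤ × ℤ → ℂ} (hc : RapidDecay c) :
    Summable fun q => ‖c q‖ := by
  simpa using hc.summable 0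

theorem norm_exp_neg_two_pi_I (x y : ℝ) (m n : ℤ) :
    ‖exp (-(2 * (π : ℂ) * I) * ((m : ℂ) * (x : ℂ) + (n : ℂ) * (y : ℂ)))‖ = 1 := by
  have : -(2 * (π : ℂ) * I) * ((m : ℂ) * (x : ℂ) + (n : ℂ) * (y : ℂ)) =
      ((-(2 * π * (m * x + n * y)) : ℝ) : ℂ) * I := by
    push_cast
    ring
  rw [this, norm_exp_ofReal_mul_I]

theorem exists_norm_fourierCoef2_le {f : ℝ × ℝ → ℂ} (hf : Continuous f) :
    ∃ C : ℝ, ∀ m n, ‖fourierCoef2 f m n‖ ≤ C := by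
  obtain ⟨C, hC⟩ := (isCompact_uIcc.prod isCompact_uIcc :
    IsCompact (Set.uIcc (0 : ℝ) 1 ×ˢ Set.uIcc (0 : ℝ) 1)).exists_bound_of_continuousOn
    hf.continuousOn
  refine ⟨C, fun m n => ?_⟩
  have hx : ∀ x ∈ Set.uIoc (0 : ℝ) 1, ‖∫ y in (0:ℝ)..1, f (x, y) *
      exp (-(2 * (π : ℂ) * I) * ((m : ℂ) * (x : ℂ) + (n : ℂ) * (y : ℂ)))‖ ≤ C := by
    intro x hx
    refine (intervalIntegral.norm_integral_le_of_norm_le_const (C := C) fun y hy => ?_).trans (by simp)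
    rw [norm_mul, norm_exp_neg_two_pi_I, mul_one]
    exact hC (x, y) ⟨Set.uIoc_subset_uIcc hx, Set.uIoc_subset_uIcc hy⟩
  exact (intervalIntegral.norm_integral_le_of_norm_le_const hx).trans (by simp)

theorem exists_abs_snd_pow_mul_norm_le (k : ℕ) {f : ℝ × ℝ → ℂ} (hf : ContDiff ℝ ∞ f)
    (hp : IsPeriodic2 f) :
    ∃ C : ℝ, ∀ m n : ℤ, |(n : ℝ)| ^ k * ‖fourierCoef2 f m n‖ ≤ C := by
  induction k generalizing f with
  | zero => simpa using exists_norm_fourierCoef2_le hf.continuous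
  | succ k ih =>
    obtain ⟨C, hC⟩ := ih (contDiff_fderiv_apply hf (0, 1)) (isPeriodic2_fderiv_apply hp (0, 1))
    refine ⟨C, fun m n => le_trans ?_ (hC m n)⟩
    rw [fourierCoef2_fderiv_snd hf hp, norm_mul, pow_succ, mul_assoc]
    gcongr
    simp only [norm_mul, norm_I, norm_intCast, mul_one, norm_ofNat, norm_real,
      Real.norm_of_nonneg Real.pi_pos.le]
    exact le_mul_of_one_le_left (abs_nonneg _) (by linarith [Real.pi_gt_three])

theorem weight_pow_le (q : ℤ × ℤ) (k : ℕ) :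
    weight q ^ k ≤ 3 ^ k * (1 + |(q.1 : ℝ)| ^ k + |(q.2 : ℝ)| ^ k) := by
  have h1 := abs_nonneg (q.1 : ℝ)
  have h2 := abs_nonneg (q.2 : ℝ)
  have hM : weight q ≤ 3 * max 1 (max |(q.1 : ℝ)| |(q.2 : ℝ)|) := by
    unfold weight
    have a1 := le_max_left 1 (max |(q.1 : ℝ)| |(q.2 : ℝ)|)
    have a2 := le_max_right 1 (max |(q.1 : ℝ)| |(q.2 : ℝ)|)
    have a3 := le_max_left |(q.1 : ℝ)| |(q.2 : ℝ)|
    have a4 := le_max_right |(q.1 : ℝ)| |(q.2 : ℝ)|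
    linarith
  have hw := one_le_weight q
  refine (pow_le_pow_left₀ (by linarith) hM k).trans ?_
  rw [mul_pow]
  gcongr
  have p1 : 0 ≤ |(q.1 : ℝ)| ^ k := by positivity
  have p2 : 0 ≤ |(q.2 : ℝ)| ^ k := by positivity
  rcases max_choice 1 (max |(q.1 : ℝ)| |(q.2 : ℝ)|) with h | h
  · rw [h, one_pow]
    linarith
  · rw [h]
    rcases max_choice |(q.1 : ℝ)| |(q.2 : ℝ)| with h | h <;> rw [h] <;> linarith

theorem rapidDecay_fourierCoef2 {f : ℝ × ℝ → ℂ} (hf : ContDiff ℝ ∞ f) (hp : IsPeriodic2 f) :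
    RapidDecay fun q => fourierCoef2 f q.1 q.2 := by
  intro k
  obtain ⟨C₀, h₀⟩ := exists_norm_fourierCoef2_le hf.continuous
  obtain ⟨C₁, h₁⟩ := exists_abs_snd_pow_mul_norm_le k
    (hf.comp (contDiff_snd.prodMk contDiff_fst) : ContDiff ℝ ∞ (f ∘ Prod.swap))
    (isPeriodic2_comp_swap hp)
  obtain ⟨C₂, h₂⟩ := exists_abs_snd_pow_mul_norm_le k hf hp
  refine ⟨3 ^ k * (C₀ + C₁ + C₂), fun q => ?_⟩
  have e₀ := h₀ q.1 q.2
  have e₁ := h₁ q.2 q.1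
  have e₂ := h₂ q.1 q.2
  rw [fourierCoef2_comp_swap hf.continuous] at e₁
  calc weight q ^ k * ‖fourierCoef2 f q.1 q.2‖
      ≤ 3 ^ k * (1 + |(q.1 : ℝ)| ^ k + |(q.2 : ℝ)| ^ k) * ‖fourierCoef2 f q.1 q.2‖ := by
        gcongr
        exact weight_pow_le q k
    _ = 3 ^ k * (‖fourierCoef2 f q.1 q.2‖ + |(q.1 : ℝ)| ^ k * ‖fourierCoef2 f q.1 q.2‖ +
          |(q.2 : ℝ)| ^ k * ‖fourierCoef2 f q.1 q.2‖) := by ring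
    _ ≤ 3 ^ k * (C₀ + C₁ + C₂) := by gcongr

/-! ### Fourier inversion -/

theorem hasSum_fourier_of_periodic {F : ℝ → ℂ} (hF : Continuous F) (hp : Function.Periodic F 1)
    {a : ℤ → ℂ} (ha : ∀ n, a n = ∫ y in (0 : ℝ)..1, F y * exp (-(2 * (π : ℂ) * I) * (n * y)))
    (hs : Summable a) (y : ℝ) : HasSum (fun n => a n * exp (2 * π * I * (n * y))) (F y) := by
  let G : C(AddCircle (1 : ℝ), ℂ) := ⟨hp.lift, continuous_coinduced_dom.mpr hF⟩
  have hG : ∀ t : ℝ, G (t : AddCircle (1 : ℝ)) = F t := fun t => hp.lift_coe t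
  have hc : fourierCoeff G = a := by
    ext n
    rw [fourierCoeff_eq_intervalIntegral _ n 0, ha]
    simp only [hG, zero_add, fourier_coe_apply, div_one, one_smul, smul_eq_mul, ofReal_one]
    congr 1
    ext t
    rw [mul_comm]
    congr 2
    push_cast
    ring
  have := has_pointwise_sum_fourier_series_of_summable (f := G) (by rwa [hc]) (y : AddCircle (1 : ℝ))
  rw [hc, hG] at this
  convert! this using 2 with n
  rw [fourier_coe_apply, smul_eq_mul]
  congr 2
  simp
  ring

/-- The character `(x, y) ↦ exp (2πi (m x + n y))` of the torus. -/
noncomputable def torusChar (q : ℤ × ℤ) (p : ℝ × ℝ) : ℂ :=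
  exp (2 * π * I * (q.1 * p.1 + q.2 * p.2))

theorem norm_torusChar (q : ℤ × ℤ) (p : ℝ × ℝ) : ‖torusChar q p‖ = 1 := by
  have : 2 * (π : ℂ) * I * (q.1 * p.1 + q.2 * p.2) =
      ((2 * π * (q.1 * p.1 + q.2 * p.2) : ℝ) : ℂ) * I := by
    push_cast
    ring
  rw [torusChar, this, norm_exp_ofReal_mul_I]

theorem isPeriodic2_torusChar (q : ℤ × ℤ) : IsPeriodic2 (torusChar q) := by
  intro x y k l
  have : 2 * (π : ℂ) * I * (q.1 * ((x + k : ℝ) : ℂ) + q.2 * ((y + l : ℝ) : ℂ)) =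
      2 * π * I * (q.1 * x + q.2 * y) + ((q.1 * k + q.2 * l : ℤ) : ℂ) * (2 * π * I) := by
    push_cast
    ring
  simp only [torusChar, this]
  exact exp_periodic.int_mul _ _

theorem hasSum_fourierCoef2_mul_torusChar {f : ℝ × ℝ → ℂ} (hf : Continuous f) (hp : IsPeriodic2 f)
    (hs : Summable fun q : ℤ × ℤ => ‖fourierCoef2 f q.1 q.2‖) (p : ℝ × ℝ) :
    HasSum (fun q : ℤ × ℤ => fourierCoef2 f q.1 q.2 * torusChar q p) (f p) := by
  obtain ⟨x, y⟩ := p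
  let A : ℤ → ℝ → ℂ := fun n x =>
    ∫ y in (0 : ℝ)..1, f (x, y) * exp (-(2 * (π : ℂ) * I) * (n * y))
  have hAc : ∀ n, Continuous (A n) := by
    intro n
    refine continuous_parametric_intervalIntegral_of_continuous' ?_ _ _
    simp only [Function.uncurry_def]
    fun_prop
  have hAp : ∀ n, Function.Periodic (A n) 1 := by
    intro n x
    simp only [A]
    congr 1
    ext y
    rw [← hp x y 1 0]
    simp
  have hs' : Summable fun q : ℤ × ℤ => ‖fourierCoef2 f q.2 q.1‖ := hs.prod_symm
  have hA : ∀ (n : ℤ) (x : ℝ),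
      HasSum (fun m : ℤ => fourierCoef2 f m n * exp (2 * π * I * (m * x))) (A n x) := by
    intro n x
    refine hasSum_fourier_of_periodic (hAc n) (hAp n) (fun m => ?_)
      (hs'.prod_factor n).of_norm x
    simp only [fourierCoef2, A, ← intervalIntegral.integral_mul_const]
    congr 1
    ext x
    congr 1
    ext y
    rw [mul_assoc (f (x, y)), ← exp_add]
    congr 2
    ring
  have hnorm : ∀ (m : ℤ) (x : ℝ), ‖exp (2 * π * I * (m * x))‖ = 1 := by
    intro m x
    simpa [torusChar] using norm_torusChar (m, 0) (x, 0)
  have hAs : Summable fun n => A n x := by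
    refine Summable.of_norm_bounded (g := fun n => ∑' m, ‖fourierCoef2 f m n‖) hs'.prod
      fun n => ?_
    rw [← (hA n x).tsum_eq]
    refine (norm_tsum_le_tsum_norm ?_).trans_eq ?_ <;> simp only [norm_mul, hnorm, mul_one]
    exact hs'.prod_factor n
  have hy := hasSum_fourier_of_periodic (F := fun y => f (x, y)) (a := fun n => A n x)
    (by fun_prop) (fun y => by simpa using hp x y 0 1) (fun n => rfl) hAs y
  have hsum : Summable fun q : ℤ × ℤ => fourierCoef2 f q.2 q.1 * torusChar q.swap (x, y) := by
    refine Summable.of_norm ?_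
    simpa only [norm_mul, norm_torusChar, mul_one] using hs'
  have hfib : ∀ n : ℤ, HasSum (fun m : ℤ => fourierCoef2 f m n * torusChar (m, n) (x, y))
      (A n x * exp (2 * π * I * (n * y))) := by
    intro n
    convert! (hA n x).mul_right (exp (2 * π * I * (n * y))) using 2 with m
    rw [torusChar, mul_assoc (fourierCoef2 f m n), ← exp_add]
    congr 2
    ring
  have htot := hsum.hasSum.prod_fiberwise hfib
  rw [hy.unique htot]
  exact (Equiv.prodComm ℤ ℤ).hasSum_iff.1 hsum.hasSum

/-! ### Fourier series with rapidly decaying coefficients -/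

theorem iteratedDeriv_exp_const_mul_ofReal (k : ℕ) (c : ℂ) :
    iteratedDeriv k (fun t : ℝ => exp (c * t)) = fun t : ℝ => c ^ k * exp (c * t) := by
  induction k with
  | zero => simp
  | succ k ih =>
    rw [iteratedDeriv_succ, ih]
    ext t
    have h : HasDerivAt (fun t : ℝ => c ^ k * exp (c * t)) (c ^ k * (exp (c * t) * (c * 1))) t :=
      (((hasDerivAt_id t).ofReal_comp.const_mul c).cexp).const_mul _
    rw [h.deriv]
    ring

/-- The real linear form `(x, y) ↦ m x + n y`. -/
noncomputable def phase (q : ℤ × ℤ) : ℝ × ℝ →L[ℝ] ℝ :=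
  (q.1 : ℝ) • ContinuousLinearMap.fst ℝ ℝ ℝ + (q.2 : ℝ) • ContinuousLinearMap.snd ℝ ℝ ℝ

theorem phase_apply (q : ℤ × ℤ) (p : ℝ × ℝ) : phase q p = q.1 * p.1 + q.2 * p.2 := by
  simp [phase]

theorem norm_phase_le (q : ℤ × ℤ) : ‖phase q‖ ≤ weight q := by
  refine ContinuousLinearMap.opNorm_le_bound _ (by linarith [one_le_weight q]) fun p => ?_
  rw [phase_apply]
  have h1 : ‖p.1‖ ≤ ‖p‖ := norm_fst_le p
  have h2 : ‖p.2‖ ≤ ‖p‖ := norm_snd_le p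
  calc ‖(q.1 : ℝ) * p.1 + q.2 * p.2‖ ≤ |(q.1 : ℝ)| * ‖p.1‖ + |(q.2 : ℝ)| * ‖p.2‖ := by
        simpa only [norm_mul, Real.norm_eq_abs] using norm_add_le ((q.1 : ℝ) * p.1) (q.2 * p.2)
    _ ≤ |(q.1 : ℝ)| * ‖p‖ + |(q.2 : ℝ)| * ‖p‖ := by gcongr
    _ ≤ weight q * ‖p‖ := by
        unfold weight
        nlinarith [norm_nonneg p]

theorem torusChar_eq_comp (q : ℤ × ℤ) :
    torusChar q = (fun t : ℝ => exp (2 * π * I * t)) ∘ phase q := by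
  ext p
  simp [torusChar, phase_apply]

theorem contDiff_exp_const_mul_ofReal (c : ℂ) : ContDiff ℝ ∞ fun t : ℝ => exp (c * t) :=
  (contDiff_const.mul ofRealCLM.contDiff).cexp

theorem contDiff_torusChar (q : ℤ × ℤ) : ContDiff ℝ ∞ (torusChar q) := by
  rw [torusChar_eq_comp]
  exact (contDiff_exp_const_mul_ofReal _).comp (phase q).contDiff

theorem fderiv_torusChar_apply (q : ℤ × ℤ) (p v : ℝ × ℝ) :
    fderiv ℝ (torusChar q) p v = 2 * π * I * (q.1 * v.1 + q.2 * v.2) * torusChar q p := by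
  have h1 : HasDerivAt (fun t : ℝ => exp (2 * π * I * t))
      (exp (2 * π * I * (phase q p : ℝ)) * (2 * π * I * 1)) (phase q p) :=
    ((hasDerivAt_id (phase q p)).ofReal_comp.const_mul (2 * π * I)).cexp
  have h2 := h1.hasFDerivAt.comp p (phase q).hasFDerivAt
  rw [torusChar_eq_comp, h2.fderiv]
  simp [phase_apply]
  ring

theorem norm_iteratedFDeriv_torusChar_le (q : ℤ × ℤ) (k : ℕ) (p : ℝ × ℝ) :
    ‖iteratedFDeriv ℝ k (torusChar q) p‖ ≤ (2 * π) ^ k * weight q ^ k := by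
  rw [torusChar_eq_comp, (phase q).iteratedFDeriv_comp_right (contDiff_exp_const_mul_ofReal _) p
    (by exact_mod_cast le_top)]
  refine (ContinuousMultilinearMap.norm_compContinuousLinearMap_le _ _).trans ?_
  rw [norm_iteratedFDeriv_eq_norm_iteratedDeriv, iteratedDeriv_exp_const_mul_ofReal]
  have h : ‖exp (2 * π * I * (phase q p : ℝ))‖ = 1 := by
    have := norm_torusChar q p
    rwa [torusChar_eq_comp] at this
  rw [norm_mul, h, norm_pow, Finset.prod_const, Finset.card_univ, Fintype.card_fin, mul_one]
  have h2 : ‖2 * (π : ℂ) * I‖ = 2 * π := by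
    simp [abs_of_pos Real.pi_pos]
  rw [h2]
  have := Real.pi_pos
  gcongr
  exact norm_phase_le q

theorem norm_iteratedFDeriv_mul_torusChar_le (d : ℤ × ℤ → ℂ) (k : ℕ) (q : ℤ × ℤ) (p : ℝ × ℝ) :
    ‖iteratedFDeriv ℝ k (fun p => d q * torusChar q p) p‖ ≤
      (2 * π) ^ k * (weight q ^ k * ‖d q‖) := by
  have h : (fun p => d q * torusChar q p) = d q • torusChar q := rfl
  rw [h, iteratedFDeriv_const_smul_apply
    ((contDiff_torusChar q).of_le (by exact_mod_cast le_top)).contDiffAt, norm_smul]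
  calc ‖d q‖ * ‖iteratedFDeriv ℝ k (torusChar q) p‖
      ≤ ‖d q‖ * ((2 * π) ^ k * weight q ^ k) := by
        gcongr
        exact norm_iteratedFDeriv_torusChar_le q k p
    _ = _ := by ring

theorem RapidDecay.contDiff_tsum {d : ℤ × ℤ → ℂ} (hd : RapidDecay d) :
    ContDiff ℝ ∞ fun p => ∑' q, d q * torusChar q p :=
  _root_.contDiff_tsum (v := fun k q => (2 * π) ^ k * (weight q ^ k * ‖d q‖))
    (fun q => contDiff_const.mul (contDiff_torusChar q))
    (fun k _ => (hd.summable k).mul_left _)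
    fun k q p _ => norm_iteratedFDeriv_mul_torusChar_le d k q p

theorem RapidDecay.hasSum_fderiv {d : ℤ × ℤ → ℂ} (hd : RapidDecay d) (p v : ℝ × ℝ) :
    HasSum (fun q => d q * (2 * π * I * (q.1 * v.1 + q.2 * v.2)) * torusChar q p)
      (fderiv ℝ (fun p => ∑' q, d q * torusChar q p) p v) := by
  have hdiff : ∀ q, Differentiable ℝ fun p => d q * torusChar q p := fun q =>
    (contDiff_const.mul (contDiff_torusChar q)).differentiable (by simp)
  have hs := (hd.summable 1).mul_left ((2 * π) ^ 1)
  have hb : ∀ q p, ‖fderiv ℝ (fun p => d q * torusChar q p) p‖ ≤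
      (2 * π) ^ 1 * (weight q ^ 1 * ‖d q‖) := fun q p => by
    rw [← norm_iteratedFDeriv_one]
    exact norm_iteratedFDeriv_mul_torusChar_le d 1 q p
  have h0 : Summable fun q => d q * torusChar q 0 := by
    refine Summable.of_norm ?_
    simpa only [norm_mul, norm_torusChar, mul_one] using hd.summable_norm
  rw [fderiv_tsum_apply hs hdiff hb h0 p]
  have hsum : Summable fun q => fderiv ℝ (fun p => d q * torusChar q p) p :=
    Summable.of_norm_bounded hs fun q => hb q p
  have := hsum.hasSum.mapL (ContinuousLinearMap.apply ℝ ℂ v)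
  simp only [ContinuousLinearMap.apply_apply] at this
  convert! this using 2 with q
  rw [fderiv_const_mul ((contDiff_torusChar q).differentiable (by simp) p),
    smul_apply, fderiv_torusChar_apply, smul_eq_mul, mul_assoc]

theorem isPeriodic2_tsum (d : ℤ × ℤ → ℂ) : IsPeriodic2 fun p => ∑' q, d q * torusChar q p := by
  intro x y k l
  simp only [isPeriodic2_torusChar _ x y k l]

/-! ### Small divisors and the cohomological equation -/

theorem exists_diophantine_bound {α : ℝ} (h1 : Irrational α) (h2 : ¬ Liouville α) :
    ∃ N : ℕ, ∀ m n : ℤ, n ≠ 0 → 1 ≤ |(m : ℝ) + α * n| * (2 * |(n : ℝ)|) ^ N := by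
  unfold Liouville at h2
  push Not at h2
  obtain ⟨N, hN⟩ := h2
  have hpos : ∀ m n : ℤ, 0 < n → 1 ≤ |(m : ℝ) + α * n| * (2 * (n : ℝ)) ^ N := by
    intro m n hn
    have hn' : (1 : ℝ) ≤ n := by exact_mod_cast hn
    have h := hN (-(2 * m)) (2 * n) (by lia) (h1.ne_rational _ _)
    push_cast at h
    have he : α - -(2 * (m : ℝ)) / (2 * n) = (m + α * n) / n := by
      field_simp
      ring
    rw [he, abs_div, abs_of_pos (by linarith : (0 : ℝ) < n),
      div_le_iff₀ (by positivity)] at h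
    refine h.trans ?_
    gcongr
    exact div_le_self (abs_nonneg _) hn'
  refine ⟨N, fun m n hn => ?_⟩
  rcases lt_or_gt_of_ne hn with h | h
  · have := hpos (-m) (-n) (by lia)
    have hn' : (n : ℝ) < 0 := by exact_mod_cast h
    rw [abs_of_neg hn', ← abs_neg]
    convert! this using 3
    · push_cast
      ring
    · push_cast
      ring
  · have hn' : (0 : ℝ) < n := by exact_mod_cast h
    rw [abs_of_pos hn']
    exact hpos m n h

theorem exists_one_le_abs_mul_weight_pow {α : ℝ} (h1 : Irrational α) (h2 : ¬ Liouville α) :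
    ∃ N : ℕ, ∀ q : ℤ × ℤ, q ≠ 0 → 1 ≤ |(q.1 : ℝ) + α * q.2| * (2 * weight q) ^ N := by
  obtain ⟨N, hN⟩ := exists_diophantine_bound h1 h2
  refine ⟨N, fun q hq => ?_⟩
  have hw := one_le_weight q
  by_cases hn : q.2 = 0
  · have hm : q.1 ≠ 0 := fun hm => hq (Prod.ext hm hn)
    have hm' : (1 : ℝ) ≤ |(q.1 : ℝ)| := by exact_mod_cast Int.one_le_abs hm
    rw [hn, Int.cast_zero, mul_zero, add_zero]
    exact one_le_mul_of_one_le_of_one_le hm' (one_le_pow₀ (by linarith))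
  · refine (hN q.1 q.2 hn).trans ?_
    gcongr
    unfold weight
    linarith [abs_nonneg (q.1 : ℝ)]

theorem RapidDecay.div_symbol {c : ℤ × ℤ → ℂ} (hc : RapidDecay c) {α : ℝ} (h1 : Irrational α)
    (h2 : ¬ Liouville α) (h0 : c 0 = 0) :
    RapidDecay fun q => c q / (2 * π * I * (q.1 + α * q.2)) := by
  obtain ⟨N, hN⟩ := exists_one_le_abs_mul_weight_pow h1 h2
  intro k
  obtain ⟨C, hC⟩ := hc (k + N)
  refine ⟨2 ^ N * C, fun q => ?_⟩
  have hw := one_le_weight q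
  have hC0 : weight q ^ (k + N) * ‖c q‖ ≤ C := hC q
  by_cases hq : q = 0
  · subst hq
    simp only [h0, norm_zero, mul_zero, zero_div] at hC0 ⊢
    positivity
  have hb := hN q hq
  have hpos : 0 < |(q.1 : ℝ) + α * q.2| := by
    by_contra h
    have : |(q.1 : ℝ) + α * q.2| = 0 := le_antisymm (not_lt.1 h) (abs_nonneg _)
    rw [this, zero_mul] at hb
    linarith
  have hn : ‖2 * (π : ℂ) * I * (q.1 + α * q.2)‖ = 2 * π * |(q.1 : ℝ) + α * q.2| := by
    have : ((q.1 : ℂ) + α * q.2) = (((q.1 : ℝ) + α * q.2 : ℝ) : ℂ) := by push_cast; rfl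
    rw [this, norm_mul, norm_real, Real.norm_eq_abs]
    simp [abs_of_pos Real.pi_pos]
  rw [norm_div, hn, mul_div_assoc', div_le_iff₀ (by positivity)]
  calc weight q ^ k * ‖c q‖
      ≤ weight q ^ k * ‖c q‖ * (|(q.1 : ℝ) + α * q.2| * (2 * weight q) ^ N) :=
        le_mul_of_one_le_right (by positivity) hb
    _ = 2 ^ N * (weight q ^ (k + N) * ‖c q‖) * |(q.1 : ℝ) + α * q.2| := by ring
    _ ≤ 2 ^ N * C * |(q.1 : ℝ) + α * q.2| := by gcongr
    _ ≤ 2 ^ N * C * (2 * π * |(q.1 : ℝ) + α * q.2|) := by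
        have hC1 : 0 ≤ C := le_trans (by positivity) hC0
        gcongr
        exact le_mul_of_one_le_left hpos.le (by linarith [Real.pi_gt_three])

theorem exists_fderiv_eq {α : ℝ} (h1 : Irrational α) (h2 : ¬ Liouville α) {f : ℝ × ℝ → ℂ}
    (hf : ContDiff ℝ ∞ f) (hp : IsPeriodic2 f) (h0 : fourierCoef2 f 0 0 = 0) :
    ∃ g : ℝ × ℝ → ℂ, ContDiff ℝ ∞ g ∧ IsPeriodic2 g ∧
      ∀ p : ℝ × ℝ, fderiv ℝ g p (1, α) = f p := by
  have hc := rapidDecay_fourierCoef2 hf hp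
  have hd := hc.div_symbol h1 h2 h0
  refine ⟨_, hd.contDiff_tsum, isPeriodic2_tsum _, fun p => ?_⟩
  refine (hd.hasSum_fderiv p (1, α)).unique ?_
  convert! hasSum_fourierCoef2_mul_torusChar hf.continuous hp hc.summable_norm p using 2 with q
  congr 1
  by_cases hq : q = 0
  · subst hq
    simp [h0]
  have hne : (q.1 : ℂ) + α * q.2 ≠ 0 := by
    obtain ⟨N, hN⟩ := exists_one_le_abs_mul_weight_pow h1 h2
    have hb := hN q hq
    intro h
    have h' : (q.1 : ℝ) + α * q.2 = 0 := by exact_mod_cast h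
    rw [h', abs_zero, zero_mul] at hb
    linarith
  have : (q.1 : ℂ) * ((1 : ℝ) : ℂ) + q.2 * α = q.1 + α * q.2 := by
    push_cast
    ring
  rw [this]
  exact div_mul_cancel₀ _ (mul_ne_zero two_pi_I_ne_zero hne)

end KroneckerTorus

/-- For irrational non-Liouville `α`, every smooth function on `𝕋²` with vanishing mean is
`Xg` for a smooth `g`, where `X = ∂ₓ + α ∂_y`; hence every smooth function is, modulo the
image of `X`, a unique constant multiple of `1`, i.e. the first foliated cohomology of the
Kronecker foliation of slope `α` is one-dimensional, spanned by the class of `1`. -/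
theorem solvable_of_not_liouville (α : ℝ) (h1 : Irrational α) (h2 : ¬ Liouville α) :
    (∀ f : ℝ × ℝ → ℂ, ContDiff ℝ (⊤ : ℕ∞) f → IsPeriodic2 f → fourierCoef2 f 0 0 = 0 →
      ∃ g : ℝ × ℝ → ℂ, ContDiff ℝ (⊤ : ℕ∞) g ∧ IsPeriodic2 g ∧
        ∀ p : ℝ × ℝ, fderiv ℝ g p (1, α) = f p) ∧
    (∀ f : ℝ × ℝ → ℂ, ContDiff ℝ (⊤ : ℕ∞) f → IsPeriodic2 f →
      ∃! c : ℂ, ∃ g : ℝ × ℝ → ℂ, ContDiff ℝ (⊤ : ℕ∞) g ∧ IsPeriodic2 g ∧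
        ∀ p : ℝ × ℝ, f p = c + fderiv ℝ g p (1, α)) := by
  refine ⟨fun f hf hp h0 => KroneckerTorus.exists_fderiv_eq h1 h2 hf hp h0, fun f hf hp => ?_⟩
  refine ⟨fourierCoef2 f 0 0, ?_, ?_⟩
  · have h0 : fourierCoef2 (fun p => f p + -fourierCoef2 f 0 0) 0 0 = 0 := by
      rw [KroneckerTorus.fourierCoef2_add hf.continuous continuous_const,
        KroneckerTorus.fourierCoef2_const_zero_zero, add_neg_cancel]
    obtain ⟨g, hg, hgp, hgf⟩ := KroneckerTorus.exists_fderiv_eq h1 h2 (hf.add contDiff_const)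
      (fun x y k l => by rw [hp x y k l]) h0
    exact ⟨g, hg, hgp, fun p => by rw [hgf p]; ring⟩
  · rintro c ⟨g, hg, hgp, hgf⟩
    rw [funext hgf]
    exact (KroneckerTorus.fourierCoef2_const_add_fderiv hg hgp c α).symm
end
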